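/- Let 𝔟 be a nonzero fractional ideal and γ = (a b; c d) ∈ GL₂(F) with a ∈ 𝔟, b ∈ (𝔟𝔠)*, c ∈ 𝔟𝔠𝔡, d ∈ 𝔟⁻¹, det γ ∈ E, and 𝔟 = a𝔬 + c𝔠*; set 𝔟' := a𝔬 + c(𝔠𝔫)*. Then for (u, ε) ∈ 𝔬^× × E there exists ξ ∈ F with γ · (uε ξ; 0 u⁻¹) · γ⁻¹ ∈ Γ if and only if u − 1 ∈ 𝔫𝔟'𝔟⁻¹ and uε − 1 ∈ 𝔟𝔟'⁻¹. Consequently the image in the standard torus of the group γ⁻¹Γγ ∩ B (B the upper triangular matrices) is exactly 𝔬_𝒞^× := { (u, ε) ∈ 𝔬^× × E : u − 1 ∈ 𝔫𝔟'𝔟⁻¹, uε − 1 ∈ 𝔟𝔟'⁻¹ }. -/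

import Mathlib

open NumberField FractionalIdeal
open scoped nonZeroDivisors

variable (F : Type*) [Field F] [NumberField F]

/-- The different ideal `𝔡` of `F`, as a fractional ideal. -/
noncomputable def diffF : FractionalIdeal (𝓞 F)⁰ F :=
  (differentIdeal ℤ (𝓞 F) : FractionalIdeal (𝓞 F)⁰ F)

/-- The congruence group `Γ = Γ₁^D(𝔠,𝔫)`: matrices `(a b; c d) ∈ GL₂(F)` with
`a ∈ 𝔬`, `b ∈ 𝔠* = 𝔠⁻¹𝔡⁻¹`, `c ∈ 𝔫𝔠𝔡`, `d ∈ 𝔬`, `d − 1 ∈ 𝔫` and determinant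
in `E`. -/
noncomputable def GammaD (𝔠 : FractionalIdeal (𝓞 F)⁰ F) (𝔫 : Ideal (𝓞 F))
    (E : Subgroup (𝓞 F)ˣ) : Set (Matrix (Fin 2) (Fin 2) F) :=
  {γ | γ 0 0 ∈ (1 : FractionalIdeal (𝓞 F)⁰ F) ∧
       γ 0 1 ∈ 𝔠⁻¹ * (diffF F)⁻¹ ∧
       γ 1 0 ∈ (𝔫 : FractionalIdeal (𝓞 F)⁰ F) * 𝔠 * diffF F ∧
       γ 1 1 ∈ (1 : FractionalIdeal (𝓞 F)⁰ F) ∧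
       γ 1 1 - 1 ∈ (𝔫 : FractionalIdeal (𝓞 F)⁰ F) ∧
       ∃ u ∈ E, ((u : 𝓞 F) : F) = γ.det}

namespace FractionalIdeal

instance addSubgroupClass {R K : Type*} [CommRing R] {S : Submonoid R} [CommRing K]
    [Algebra R K] : AddSubgroupClass (FractionalIdeal S K) K where
  add_mem {I} _ _ hx hy := (I : Submodule R K).add_mem hx hy
  zero_mem I := (I : Submodule R K).zero_mem
  neg_mem {I} _ hx := (I : Submodule R K).neg_mem hx

section Dedekind

variable {R K : Type*} [CommRing R] [IsDedekindDomain R] [Field K] [Algebra R K]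
  [IsFractionRing R K]

theorem le_mul_inv_iff_mul_le {I J L : FractionalIdeal R⁰ K} (hJ : J ≠ 0) :
    L ≤ I * J⁻¹ ↔ L * J ≤ I := by
  constructor <;> intro h
  · simpa [mul_assoc, inv_mul_cancel₀ hJ] using mul_le_mul' h (le_refl J)
  · simpa [mul_assoc, mul_inv_cancel₀ hJ] using mul_le_mul' h (le_refl J⁻¹)

theorem mem_mul_inv_add_iff {I J X : FractionalIdeal R⁰ K} {a c s : K} (hJ : J ≠ 0)
    (hX : X ≠ 0) (hXeq : X = spanSingleton R⁰ a + spanSingleton R⁰ c * J) :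
    s ∈ I * X⁻¹ ↔ a * s ∈ I ∧ c * s ∈ I * J⁻¹ := by
  rw [← spanSingleton_le_iff_mem, le_mul_inv_iff_mul_le hX, hXeq, mul_add,
    ← sup_eq_add, sup_le_iff, spanSingleton_mul_spanSingleton, ← mul_assoc,
    spanSingleton_mul_spanSingleton, ← le_mul_inv_iff_mul_le hJ, spanSingleton_le_iff_mem,
    spanSingleton_le_iff_mem, mul_comm s a, mul_comm s c]

theorem exists_row_iff {N C B B' : FractionalIdeal R⁰ K} {a c x y : K}
    (hN : N ≠ 0) (hN1 : N ≤ 1) (hC : C ≠ 0) (hB : B ≠ 0)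
    (hBeq : B = spanSingleton R⁰ a + spanSingleton R⁰ c * C)
    (hB'eq : B' = spanSingleton R⁰ a + spanSingleton R⁰ c * (C * N⁻¹)) :
    (∃ r s : K, a * r ∈ (1 : FractionalIdeal R⁰ K) ∧ a * s ∈ C ∧ c * r ∈ N * C⁻¹ ∧
      c * s ∈ (1 : FractionalIdeal R⁰ K) ∧ y - 1 + c * s ∈ N ∧ a * r + c * s = x - y) ↔
    y - 1 ∈ N * B' * B⁻¹ ∧ x - 1 ∈ B * B'⁻¹ := by
  have hNB' : N * B' = N * spanSingleton R⁰ a + spanSingleton R⁰ c * C := by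
    rw [hB'eq]; field_simp
  have hNa : N * spanSingleton R⁰ a ≤ spanSingleton R⁰ a := by
    simpa using mul_le_mul' hN1 (le_refl (spanSingleton R⁰ a))
  have hNcC : N * (spanSingleton R⁰ c * C) ≤ spanSingleton R⁰ c * C := by
    simpa using mul_le_mul' hN1 (le_refl (spanSingleton R⁰ c * C))
  have hB_eq : B = spanSingleton R⁰ a + N * B' := by
    rw [hNB', hBeq, ← add_assoc]
    simp only [← sup_eq_add] at *
    rw [sup_eq_left.2 hNa]
  have hNB'_eq : N * B' = spanSingleton R⁰ c * C + N * B := by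
    rw [hNB', hBeq, mul_add]
    simp only [← sup_eq_add] at *
    rw [sup_left_comm, sup_eq_left.2 hNcC]
  have hB' : B' ≠ 0 := by
    rintro rfl
    rw [mul_zero, ← sup_eq_add] at hNB'_eq
    have h : N * B ≤ 0 := hNB'_eq ▸ le_sup_right
    exact mul_ne_zero hN hB (le_zero_iff.1 h)
  have h₁ : N * B' * B⁻¹ = spanSingleton R⁰ c * (C * B⁻¹) + N := by
    rw [hNB'_eq, add_mul, mul_assoc, mul_assoc, mul_inv_cancel₀ hB, mul_one]
  have h₂ : B * B'⁻¹ = spanSingleton R⁰ a * B'⁻¹ + N := by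
    conv_lhs => rw [hB_eq]
    rw [add_mul, mul_assoc, mul_inv_cancel₀ hB', mul_one]
  have h₃ : N = spanSingleton R⁰ a * (N * B⁻¹) + spanSingleton R⁰ c * (C * (N * B⁻¹)) := by
    rw [← mul_assoc (spanSingleton R⁰ c), ← add_mul, ← hBeq]
    field_simp
  have hNB_le : N * B⁻¹ ≤ B'⁻¹ := by
    rw [← one_mul B'⁻¹, le_mul_inv_iff_mul_le hB', mul_right_comm,
      ← le_mul_inv_iff_mul_le (inv_ne_zero hB), inv_inv, one_mul, hB_eq, ← sup_eq_add]
    exact le_sup_right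
  have hr (r : K) : r ∈ B'⁻¹ ↔ a * r ∈ (1 : FractionalIdeal R⁰ K) ∧ c * r ∈ N * C⁻¹ := by
    have := mem_mul_inv_add_iff (I := 1) (s := r)
      (mul_ne_zero hC (inv_ne_zero hN)) hB' hB'eq
    rwa [one_mul, one_mul, mul_inv, inv_inv, mul_comm C⁻¹] at this
  have hs (s : K) : s ∈ C * B⁻¹ ↔ a * s ∈ C ∧ c * s ∈ (1 : FractionalIdeal R⁰ K) := by
    have := mem_mul_inv_add_iff (I := C) (s := s) hC hB hBeq
    rwa [mul_inv_cancel₀ hC] at this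
  rw [h₁, h₂]
  constructor
  · rintro ⟨r, s, har, has, hcr, hcs, hys, hrs⟩
    refine ⟨(mem_add _ _ _).2 ⟨c * -s, mem_singleton_mul.2 ⟨-s, neg_mem ((hs s).2 ⟨has, hcs⟩),
      rfl⟩, _, hys, by ring⟩, (mem_add _ _ _).2 ⟨a * r, mem_singleton_mul.2 ⟨r,
      (hr r).2 ⟨har, hcr⟩, rfl⟩, _, hys, by linear_combination hrs⟩⟩
  · rintro ⟨hy, hx⟩
    obtain ⟨_, hi, n₀, hn₀, hy⟩ := (mem_add _ _ _).1 hy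
    obtain ⟨s₀, hs₀, rfl⟩ := mem_singleton_mul.1 hi
    obtain ⟨_, hj, n₁, hn₁, hx⟩ := (mem_add _ _ _).1 hx
    obtain ⟨r₀, hr₀, rfl⟩ := mem_singleton_mul.1 hj
    have hn : n₁ - n₀ ∈ N := sub_mem hn₁ hn₀
    rw [h₃] at hn
    obtain ⟨_, hi, _, hj, hn⟩ := (mem_add _ _ _).1 hn
    obtain ⟨r₁, hr₁, rfl⟩ := mem_singleton_mul.1 hi
    obtain ⟨s₁, hs₁, rfl⟩ := mem_singleton_mul.1 hj
    have hcs₁ : c * s₁ ∈ N := by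
      rw [h₃]
      exact (mem_add _ _ _).2 ⟨0, zero_mem _, _, mem_singleton_mul.2 ⟨s₁, hs₁, rfl⟩, zero_add _⟩
    have hs₁' : s₁ ∈ C * B⁻¹ := by
      refine (?_ : C * (N * B⁻¹) ≤ C * B⁻¹) hs₁
      simpa [mul_left_comm] using mul_le_mul' hN1 (le_refl (C * B⁻¹))
    obtain ⟨har, hcr⟩ := (hr (r₀ + r₁)).1 (add_mem hr₀ (hNB_le hr₁))
    obtain ⟨has, hcs⟩ := (hs (-s₀ + s₁)).1 (add_mem (neg_mem hs₀) hs₁')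
    refine ⟨r₀ + r₁, -s₀ + s₁, har, has, hcr, hcs, ?_, by linear_combination hn + hx - hy⟩
    convert add_mem hn₀ hcs₁ using 1
    linear_combination -hy

theorem mul_mem_of_mem_one {I : FractionalIdeal R⁰ K} {z t : K}
    (hz : z ∈ (1 : FractionalIdeal R⁰ K)) (ht : t ∈ I) : z * t ∈ I := by
  simpa using mul_mem_mul hz ht

end Dedekind

end FractionalIdeal

theorem conj_upperTriangular_eq {K : Type*} [Field K] {a b c d x y ξ r s : K}
    (hdet : (!![a, b; c, d] : Matrix (Fin 2) (Fin 2) K).det ≠ 0)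
    (hrs : a * r + c * s = x - y) (hξ : b * r + d * s = ξ) :
    !![a, b; c, d] * !![x, ξ; 0, y] * (!![a, b; c, d])⁻¹ =
      !![y + a * r, a * s; c * r, y + c * s] := by
  have : Invertible (!![a, b; c, d] : Matrix (Fin 2) (Fin 2) K) :=
    Matrix.invertibleOfIsUnitDet _ hdet.isUnit
  rw [Matrix.mul_inv_eq_iff_eq_mul_of_invertible]
  subst hξ
  obtain rfl : x = y + (a * r + c * s) := by linear_combination -hrs
  ext i j
  fin_cases i <;> fin_cases j <;> simp [Matrix.mul_apply, Fin.sum_univ_two] <;> ring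

/-- Proposition `deuxideaux (iv)`, torus part: with `𝔟 = a𝔬 + c𝔠*` and
`𝔟' = a𝔬 + c(𝔠𝔫)*`, a pair `(u, ε) ∈ 𝔬^× × E` arises as the diagonal of an
element `γ (uε ξ; 0 u⁻¹) γ⁻¹ ∈ Γ` for some `ξ ∈ F` if and only if
`u − 1 ∈ 𝔫𝔟'𝔟⁻¹` and `uε − 1 ∈ 𝔟𝔟'⁻¹`; that is, the image in the standard
torus of `γ⁻¹Γγ ∩ B` is exactly the group `𝔬_𝒞^×`. -/
theorem stmt6
    (htotreal : ∀ φ : F →+* ℂ, ComplexEmbedding.IsReal φ)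
    (𝔠 : FractionalIdeal (𝓞 F)⁰ F) (h𝔠 : 𝔠 ≠ 0)
    (𝔫 : Ideal (𝓞 F)) (h𝔫 : 𝔫 ≠ 0)
    (E : Subgroup (𝓞 F)ˣ)
    (hE : ∀ u ∈ E, ∀ φ : F →+* ℝ, 0 < φ ((u : 𝓞 F) : F))
    (𝔟 : FractionalIdeal (𝓞 F)⁰ F) (h𝔟 : 𝔟 ≠ 0)
    (a b c d : F)
    (ha : a ∈ 𝔟) (hb : b ∈ (𝔟 * 𝔠)⁻¹ * (diffF F)⁻¹)
    (hc : c ∈ 𝔟 * 𝔠 * diffF F) (hd : d ∈ 𝔟⁻¹)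
    (hdet : ∃ u ∈ E, ((u : 𝓞 F) : F) = (!![a, b; c, d] : Matrix (Fin 2) (Fin 2) F).det)
    (h𝔟eq : 𝔟 = spanSingleton (𝓞 F)⁰ a +
      spanSingleton (𝓞 F)⁰ c * (𝔠⁻¹ * (diffF F)⁻¹))
    (𝔟' : FractionalIdeal (𝓞 F)⁰ F)
    (h𝔟' : 𝔟' = spanSingleton (𝓞 F)⁰ a +
      spanSingleton (𝓞 F)⁰ c * ((𝔠 * (𝔫 : FractionalIdeal (𝓞 F)⁰ F))⁻¹ * (diffF F)⁻¹)) :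
    ∀ u : (𝓞 F)ˣ, ∀ ε ∈ E,
      ((∃ ξ : F, !![a, b; c, d] *
          !![((u : 𝓞 F) : F) * ((ε : 𝓞 F) : F), ξ; 0, (((u⁻¹ : (𝓞 F)ˣ) : 𝓞 F) : F)] *
          (!![a, b; c, d])⁻¹ ∈ GammaD F 𝔠 𝔫 E) ↔
        (((u : 𝓞 F) : F) - 1 ∈ (𝔫 : FractionalIdeal (𝓞 F)⁰ F) * 𝔟' * 𝔟⁻¹ ∧
          ((u : 𝓞 F) : F) * ((ε : 𝓞 F) : F) - 1 ∈ 𝔟 * 𝔟'⁻¹)) := by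
  intro u ε hε
  set N : FractionalIdeal (𝓞 F)⁰ F := (𝔫 : FractionalIdeal (𝓞 F)⁰ F) with hNdef
  set C : FractionalIdeal (𝓞 F)⁰ F := 𝔠⁻¹ * (diffF F)⁻¹ with hCdef
  set x : F := ((u : 𝓞 F) : F) * ((ε : 𝓞 F) : F)
  set y : F := (((u⁻¹ : (𝓞 F)ˣ) : 𝓞 F) : F) with hy
  have huy : ((u : 𝓞 F) : F) * y = 1 := by
    rw [hy, ← map_mul, ← Units.val_mul, mul_inv_cancel, Units.val_one, map_one]
  have hyε : x * y = ((ε : 𝓞 F) : F) := by linear_combination ((ε : 𝓞 F) : F) * huy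
  have hdiff : diffF F ≠ 0 := by
    rw [diffF, ne_eq, coeIdeal_eq_zero]
    exact differentIdeal_ne_bot
  have hN : N ≠ 0 := by rwa [hNdef, ne_eq, coeIdeal_eq_zero]
  have hC : C ≠ 0 := mul_ne_zero (inv_ne_zero h𝔠) (inv_ne_zero hdiff)
  have hNC : N * 𝔠 * diffF F = N * C⁻¹ := by
    rw [hCdef, mul_inv, inv_inv, inv_inv, mul_assoc]
  have hCN : (𝔠 * N)⁻¹ * (diffF F)⁻¹ = C * N⁻¹ := by
    rw [hCdef, mul_inv, mul_right_comm]
  have hone (v : 𝓞 F) : (v : F) ∈ (1 : FractionalIdeal (𝓞 F)⁰ F) := coe_mem_one _ v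
  have hdet0 : (!![a, b; c, d] : Matrix (Fin 2) (Fin 2) F).det ≠ 0 := by
    obtain ⟨v, -, hv⟩ := hdet
    rw [← hv]
    simp
  have hdetrow : a * d - b * c ≠ 0 := by simpa [Matrix.det_fin_two] using hdet0
  have hmem {ξ r s : F} (hrs : a * r + c * s = x - y) (hξ : b * r + d * s = ξ) :
      !![a, b; c, d] * !![x, ξ; 0, y] * (!![a, b; c, d])⁻¹ ∈ GammaD F 𝔠 𝔫 E ↔
        a * r ∈ (1 : FractionalIdeal (𝓞 F)⁰ F) ∧ a * s ∈ C ∧ c * r ∈ N * C⁻¹ ∧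
          c * s ∈ (1 : FractionalIdeal (𝓞 F)⁰ F) ∧ y - 1 + c * s ∈ N := by
    have hadd (z : F) : y + z ∈ (1 : FractionalIdeal (𝓞 F)⁰ F) ↔
        z ∈ (1 : FractionalIdeal (𝓞 F)⁰ F) := add_mem_cancel_left (hone _)
    have hunit : ∃ v ∈ E, ((v : 𝓞 F) : F) =
        (!![y + a * r, a * s; c * r, y + c * s] : Matrix (Fin 2) (Fin 2) F).det :=
      ⟨ε, hε, by rw [Matrix.det_fin_two_of]; linear_combination -hyε - y * hrs⟩
    rw [conj_upperTriangular_eq hdet0 hrs hξ, GammaD, Set.mem_ofPred_eq, ← hNdef, ← hCdef, hNC]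
    simp only [hunit, and_true, Matrix.of_apply, Matrix.cons_val', Matrix.cons_val_zero,
      Matrix.cons_val_one, Matrix.cons_val_fin_one, hadd, add_sub_right_comm]
  have hsub : ((u : 𝓞 F) : F) - 1 ∈ N * 𝔟' * 𝔟⁻¹ ↔ y - 1 ∈ N * 𝔟' * 𝔟⁻¹ := by
    constructor <;> intro h
    · convert neg_mem (mul_mem_of_mem_one (hone (u⁻¹ : (𝓞 F)ˣ)) h) using 1
      linear_combination huy
    · convert neg_mem (mul_mem_of_mem_one (hone u) h) using 1
      linear_combination huy
  rw [hsub, ← exists_row_iff hN coeIdeal_le_one hC h𝔟 h𝔟eq (hCN ▸ h𝔟')]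
  constructor
  · rintro ⟨ξ, h⟩
    have hrs : a * (((x - y) * d - c * ξ) / (a * d - b * c)) +
        c * ((a * ξ - b * (x - y)) / (a * d - b * c)) = x - y := by
      rw [← mul_div_assoc, ← mul_div_assoc, ← add_div, div_eq_iff hdetrow]
      ring
    have hξ : b * (((x - y) * d - c * ξ) / (a * d - b * c)) +
        d * ((a * ξ - b * (x - y)) / (a * d - b * c)) = ξ := by
      rw [← mul_div_assoc, ← mul_div_assoc, ← add_div, div_eq_iff hdetrow]
      ring
    obtain ⟨h1, h2, h3, h4, h5⟩ := (hmem hrs hξ).1 h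
    exact ⟨_, _, h1, h2, h3, h4, h5, hrs⟩
  · rintro ⟨r, s, h1, h2, h3, h4, h5, hrs⟩
    exact ⟨_, (hmem hrs rfl).2 ⟨h1, h2, h3, h4, h5⟩⟩
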